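/- arXiv:2502.13796 — 7 statements merged into one kernel-verified Lean document; each statement's English description precedes it below -/
import Mathlib

section
/- Let R be a ring with involution * in which 2 is invertible, and let u ∈ R be a unitary element (i.e. u·u* = 1 = u*·u). Then u is a Cayley unitary element (i.e. there exists a skew-symmetric element k ∈ R with k* = −k such that 1+k is invertible and u = (1−k)(1+k)⁻¹) if and only if 1+u is invertible in R. -/
/-- In a ring `R` with involution in which `2` is invertible, a unitary
element `u` (i.e. `u * star u = 1 = star u * u`) is a Cayley unitary element
(i.e. `u = (1 - k) * (1 + k)⁻¹` for some skew-symmetric `k` with `1 + k` invertible)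
if and only if `1 + u` is invertible. -/
theorem cayley_unitary_iff_one_add_isUnit {R : Type*} [Ring R] [StarRing R]
    (h2 : IsUnit (2 : R)) (u : R) (hu : u * star u = 1) (hu' : star u * u = 1) :
    (∃ k : R, star k = -k ∧ IsUnit (1 + k) ∧ u = (1 - k) * Ring.inverse (1 + k)) ↔
      IsUnit (1 + u) := by
  constructor
  · rintro ⟨k, -, hk, rfl⟩
    have h : (1 + (1 - k) * Ring.inverse (1 + k)) * (1 + k) = 2 := by
      rw [add_mul, mul_assoc, Ring.inverse_mul_cancel _ hk, one_mul, mul_one, ← one_add_one_eq_two]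
      abel
    obtain ⟨a, ha⟩ := hk
    rw [← h, ← ha] at h2
    simpa only [ha] using (Units.isUnit_mul_units _ a).1 h2
  · intro hv
    obtain ⟨w, hw, hw'⟩ := isUnit_iff_exists.1 hv
    have hadd : 1 + (1 - u) * w = 2 * w := by
      nth_rw 1 [← hw]
      noncomm_ring
    have hsub : 1 - (1 - u) * w = u * (2 * w) := by
      nth_rw 1 [← hw]
      noncomm_ring
    have hunit : IsUnit (2 * w) := h2.mul (isUnit_iff_exists.2 ⟨_, hw', hw⟩)
    refine ⟨(1 - u) * w, ?_, hadd ▸ hunit, ?_⟩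
    · have hs : star w * (1 + star u) = 1 := by
        simpa using congrArg star hw
      have hcomm : (1 - star u) * (1 + u) = -((1 + star u) * (1 - u)) := by
        simp only [add_mul, sub_mul, mul_add, mul_sub, hu', one_mul, mul_one]
        abel
      calc star ((1 - u) * w) = star w * ((1 - star u) * ((1 + u) * w)) := by simp [hw]
        _ = star w * ((1 - star u) * (1 + u)) * w := by simp only [mul_assoc]
        _ = -(star w * (1 + star u) * ((1 - u) * w)) := by
          rw [hcomm]
          simp only [mul_neg, neg_mul, mul_assoc]
        _ = -((1 - u) * w) := by rw [hs, one_mul]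
    · rw [hadd, hsub, mul_assoc, Ring.mul_inverse_cancel _ hunit, mul_one]
end

section
/- Let R be a ring with involution * in which 2 is invertible, and let u ∈ R be a unitary element (u·u* = 1 = u*·u). Then u is a product of two Cayley unitary elements if and only if there exists a skew-symmetric element k ∈ R (k* = −k) with 1+k invertible such that (1+u) − (1−u)k is invertible in R. -/
section CayleyUnitary

variable {R : Type*} [Ring R]

theorem isUnit_one_add_cayley (h2 : IsUnit (2 : R)) {k : R} (hk : IsUnit (1 + k)) :
    IsUnit (1 + (1 - k) * Ring.inverse (1 + k)) := by
  have h : 1 + (1 - k) * Ring.inverse (1 + k) = 2 * Ring.inverse (1 + k) := by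
    nth_rewrite 1 [← Ring.mul_inverse_cancel _ hk]
    rw [← add_mul]
    congr 1
    rw [← one_add_one_eq_two]
    abel
  rw [h]
  exact h2.mul hk.ringInverse

theorem cayley_add_mul_one_add {k : R} (hk : IsUnit (1 + k)) (u : R) :
    ((1 - k) * Ring.inverse (1 + k) + u) * (1 + k) = (1 + u) - (1 - u) * k := by
  rw [add_mul, mul_assoc, Ring.inverse_mul_cancel _ hk]
  noncomm_ring

variable [StarRing R]

theorem cayley_mem_unitary {k : R} (hs : star k = -k) (hk : IsUnit (1 + k)) :
    (1 - k) * Ring.inverse (1 + k) ∈ unitary R := by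
  have hstar : star (1 + k) = 1 - k := by rw [star_add, star_one, hs, sub_eq_add_neg]
  have hk' : IsUnit (1 - k) := hstar ▸ hk.star
  have hcomm : (1 + k) * (1 - k) = (1 - k) * (1 + k) := by noncomm_ring
  have hs' : star ((1 - k) * Ring.inverse (1 + k)) = Ring.inverse (1 - k) * (1 + k) := by
    rw [star_mul, ← Ring.inverse_star, hstar, ← hstar, star_star]
  rw [Unitary.mem_iff, hs']
  obtain ⟨a, ha⟩ := hk
  obtain ⟨b, hb⟩ := hk'
  rw [← ha, ← hb] at hcomm ⊢
  have hab : a * b = b * a := Units.ext hcomm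
  simp only [Ring.inverse_unit]
  norm_cast
  simp only [Units.val_eq_one]
  constructor
  · calc b⁻¹ * a * (b * a⁻¹) = b⁻¹ * (a * b) * a⁻¹ := by group
      _ = 1 := by rw [hab]; group
  · calc b * a⁻¹ * (b⁻¹ * a) = b * (b * a)⁻¹ * a := by group
      _ = 1 := by rw [← hab]; group

theorem exists_eq_cayley_of_mem_unitary (h2 : IsUnit (2 : R)) {v : R} (hv : v ∈ unitary R)
    (h : IsUnit (1 + v)) :
    ∃ k : R, star k = -k ∧ IsUnit (1 + k) ∧ v = (1 - k) * Ring.inverse (1 + k) := by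
  obtain ⟨a, ha⟩ := h
  have hcomm : (1 - v) * (a : R) = a * (1 - v) := by rw [ha]; noncomm_ring
  have hadd : 1 + (1 - v) * ((a⁻¹ : Rˣ) : R) = 2 * ((a⁻¹ : Rˣ) : R) := by
    rw [← a.mul_inv, ← add_mul, a.mul_inv, ha, ← one_add_one_eq_two]
    congr 1
    abel
  have hsub : 1 - (1 - v) * ((a⁻¹ : Rˣ) : R) = v * (2 * ((a⁻¹ : Rˣ) : R)) := by
    rw [← a.mul_inv, ← sub_mul, a.mul_inv, ha, ← mul_assoc]
    congr 1
    noncomm_ring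
  have hunit : IsUnit (1 + (1 - v) * ((a⁻¹ : Rˣ) : R)) := hadd ▸ h2.mul a⁻¹.isUnit
  refine ⟨(1 - v) * ((a⁻¹ : Rˣ) : R), ?_, hunit, ?_⟩
  · have hstar : star (a : R) = star v * a := by
      rw [ha, star_add, star_one, mul_add, mul_one, Unitary.star_mul_self_of_mem hv, add_comm]
    have hstar' : star (a : R) = a * star v := by
      rw [ha, star_add, star_one, add_mul, one_mul, Unitary.mul_star_self_of_mem hv, add_comm]
    have hdiff : star (1 - v) = -((1 - v) * star v) := by
      rw [star_sub, star_one, sub_mul, one_mul, Unitary.mul_star_self_of_mem hv, neg_sub]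
    apply (star a).isUnit.mul_left_cancel
    rw [star_mul, ← mul_assoc, Units.coe_star, ← star_mul, a.inv_mul, star_one, one_mul, hdiff,
      mul_neg, neg_inj, hstar]
    have hvv : (1 - v) * star v = star v * (1 - v) := by
      rw [sub_mul, mul_sub, Unitary.mul_star_self_of_mem hv, Unitary.star_mul_self_of_mem hv,
        one_mul, mul_one]
    rw [hvv, mul_assoc, ← mul_assoc (a : R), ← hcomm, mul_assoc (1 - v), a.mul_inv, mul_one]
  · rw [hsub, ← hadd, mul_assoc, Ring.mul_inverse_cancel _ hunit, mul_one]

end CayleyUnitary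

/-- In a ring `R` with involution in which `2` is invertible, a unitary
element `u` is a product of two Cayley unitary elements if and only if there is a
skew-symmetric element `k` with `1 + k` invertible such that `(1 + u) - (1 - u) * k`
is invertible. -/
theorem product_of_two_cayley_iff {R : Type*} [Ring R] [StarRing R]
    (h2 : IsUnit (2 : R)) (u : R) (hu : u * star u = 1) (hu' : star u * u = 1) :
    (∃ k₁ k₂ : R, star k₁ = -k₁ ∧ star k₂ = -k₂ ∧ IsUnit (1 + k₁) ∧ IsUnit (1 + k₂) ∧
        u = ((1 - k₁) * Ring.inverse (1 + k₁)) * ((1 - k₂) * Ring.inverse (1 + k₂))) ↔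
      (∃ k : R, star k = -k ∧ IsUnit (1 + k) ∧ IsUnit ((1 + u) - (1 - u) * k)) := by
  have hu₀ : u ∈ unitary R := Unitary.mem_iff.mpr ⟨hu', hu⟩
  constructor
  · rintro ⟨k₁, k₂, hs₁, -, h₁, h₂, hprod⟩
    refine ⟨k₁, hs₁, h₁, ?_⟩
    rw [← cayley_add_mul_one_add h₁]
    refine IsUnit.mul ?_ h₁
    rw [hprod, ← mul_one_add]
    have hv := cayley_mem_unitary hs₁ h₁
    exact (Unitary.toUnits ⟨_, hv⟩).isUnit.mul (isUnit_one_add_cayley h2 h₂)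
  · rintro ⟨k, hs, hk, h⟩
    have hv := cayley_mem_unitary hs hk
    rw [← cayley_add_mul_one_add hk] at h
    have hadd := (IsUnit.mul_right_iff hk).mp h
    set v := (1 - k) * Ring.inverse (1 + k) with hvdef
    have hw : star v * u ∈ unitary R := mul_mem (Unitary.star_mem hv) hu₀
    have hw' : IsUnit (1 + star v * u) := by
      rw [← Unitary.star_mul_self_of_mem hv, ← mul_add]
      exact (Unitary.toUnits ⟨_, Unitary.star_mem hv⟩).isUnit.mul hadd
    obtain ⟨k₂, hs₂, h₂, heq⟩ := exists_eq_cayley_of_mem_unitary h2 hw hw'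
    refine ⟨k, k₂, hs, hs₂, hk, h₂, ?_⟩
    rw [← heq, ← hvdef, ← mul_assoc, Unitary.mul_star_self_of_mem hv, one_mul]
end

section
/- Let F be a field of characteristic zero, G a group, and x ∈ G an element of order n > 2. Then 1 + x − x⁻¹ is invertible in the group algebra FG and its inverse is a₀ + a₁x + ⋯ + a_{n−1}x^{n−1}, where a_i = (F_i + (−1)^i F_{n−i}) / (F_{n+1} + F_{n−1} − (1+(−1)ⁿ)) for i = 0, 1, …, n−1, and (F_i) denotes the Fibonacci sequence (F_0 = 0, F_1 = 1, F_i = F_{i−1} + F_{i−2}). -/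
/-- Telescoping: multiplying a truncated generating function of a Fibonacci-type sequence
by `X² + X - 1` leaves only boundary terms. -/
theorem sq_add_sub_one_mul_sum_of_fib_rec {R A : Type*} [CommRing R] [Ring A] [Algebra R A]
    (X : A) (b : ℕ → R) (n : ℕ) (hb : ∀ i, i + 2 ≤ n → b (i + 2) = b (i + 1) + b i)
    (m : ℕ) (hm : m + 1 ≤ n) :
    (X ^ 2 + X - 1) * ∑ i ∈ Finset.range (m + 1), b i • X ^ i =
      (b 0 - b 1) • X - b 0 • (1 : A) + b (m + 1) • X ^ (m + 1) + b m • X ^ (m + 2) := by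
  induction m with
  | zero =>
    simp only [zero_add, Finset.sum_range_one, pow_zero, pow_one, mul_smul_comm, mul_one]
    module
  | succ m ih =>
    have hX : (X ^ 2 + X - 1) * X ^ (m + 1) = X ^ (m + 3) + X ^ (m + 2) - X ^ (m + 1) := by
      rw [sub_mul, add_mul, ← pow_add, ← pow_succ', one_mul, show 2 + (m + 1) = m + 3 by ring]
    rw [Finset.sum_range_succ, mul_add, ih (by omega), mul_smul_comm, hX, hb m hm]
    module

/-- The sequence `Fᵢ + (-1)ⁱ F_{n-i}` satisfies the Fibonacci recurrence up to index `n`. -/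
theorem fib_add_neg_one_pow_mul_fib_rec {R : Type*} [CommRing R] (n i : ℕ) (hi : i + 2 ≤ n) :
    (Nat.fib (i + 2) : R) + (-1) ^ (i + 2) * (Nat.fib (n - (i + 2)) : R) =
      (Nat.fib (i + 1) + (-1) ^ (i + 1) * (Nat.fib (n - (i + 1)) : R)) +
        (Nat.fib i + (-1) ^ i * (Nat.fib (n - i) : R)) := by
  obtain ⟨k, rfl⟩ := Nat.exists_eq_add_of_le hi
  rw [show i + 2 + k - (i + 2) = k by omega, show i + 2 + k - (i + 1) = k + 1 by omega,
    show i + 2 + k - i = k + 2 by omega, Nat.fib_add_two, Nat.fib_add_two]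
  push_cast
  ring

theorem fib_add_fib_sub_ne_zero {R : Type*} [Ring R] [CharZero R] (n : ℕ) (hn : 2 < n) :
    (Nat.fib (n + 1) : R) + (Nat.fib (n - 1) : R) - (1 + (-1 : R) ^ n) ≠ 0 := by
  have h₁ : 3 ≤ Nat.fib (n + 1) := Nat.fib_mono (show 4 ≤ n + 1 by omega)
  rcases neg_one_pow_eq_or R n with h | h <;> rw [h, sub_ne_zero]
  · norm_cast
    omega
  · rw [add_neg_cancel]
    norm_cast
    omega

/-- Over a field of characteristic `0`, if `x ∈ G` has order `n > 2`, then
`1 + x - x⁻¹` is invertible in `FG` with inverse `∑_{i=0}^{n-1} aᵢ xⁱ`, where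
`aᵢ = (Fᵢ + (-1)ⁱ F_{n-i}) / (F_{n+1} + F_{n-1} - (1 + (-1)ⁿ))` and `(Fᵢ)` is the
Fibonacci sequence. -/
theorem inverse_of_one_add_skew_fib (F : Type*) [Field F] [CharZero F]
    {G : Type*} [Group G] (x : G) (n : ℕ) (hn : orderOf x = n) (hn2 : 2 < n) :
    let X : MonoidAlgebra F G := MonoidAlgebra.of F G x
    let D : F := (Nat.fib (n + 1) : F) + (Nat.fib (n - 1) : F) - (1 + (-1 : F) ^ n)
    let a : ℕ → F := fun i => ((Nat.fib i : F) + (-1 : F) ^ i * (Nat.fib (n - i) : F)) / D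
    let S : MonoidAlgebra F G := ∑ i ∈ Finset.range n, a i • X ^ i
    (1 + X - MonoidAlgebra.of F G x⁻¹) * S = 1 ∧
      S * (1 + X - MonoidAlgebra.of F G x⁻¹) = 1 := by
  intro X D a S
  have hD : D ≠ 0 := fib_add_fib_sub_ne_zero n hn2
  have hXY : X * MonoidAlgebra.of F G x⁻¹ = 1 := by rw [← map_mul, mul_inv_cancel, map_one]
  have hYX : MonoidAlgebra.of F G x⁻¹ * X = 1 := by rw [← map_mul, inv_mul_cancel, map_one]
  have hXn : X ^ n = 1 := by rw [← map_pow, ← hn, pow_orderOf_eq_one, map_one]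
  have hrec : ∀ i, i + 2 ≤ n → a (i + 2) = a (i + 1) + a i := fun i hi => by
    simp only [a]
    rw [fib_add_neg_one_pow_mul_fib_rec n i hi, add_div]
  obtain ⟨m, rfl⟩ : ∃ m, n = m + 1 := ⟨n - 1, by omega⟩
  have hper : a (m + 1) = a 0 := by simp [a]
  have hcoeff : a 0 - a 1 + a m = 1 := by
    simp only [a, ← add_div, ← sub_div]
    rw [div_eq_one_iff_eq hD]
    simp only [D, Nat.fib_add_two, Nat.add_sub_cancel, Nat.add_sub_cancel_left, pow_succ]
    simp
    ring
  have hmain : (X ^ 2 + X - 1) * S = X := by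
    have h := sq_add_sub_one_mul_sum_of_fib_rec X a (m + 1) hrec m le_rfl
    rw [show m + 2 = m + 1 + 1 from rfl, pow_succ X (m + 1), hXn, one_mul, hper] at h
    rw [h, sub_add_cancel, ← add_smul, hcoeff, one_smul]
  have hleft : (1 + X - MonoidAlgebra.of F G x⁻¹) * S = 1 := by
    have hfac : 1 + X - MonoidAlgebra.of F G x⁻¹ =
        MonoidAlgebra.of F G x⁻¹ * (X ^ 2 + X - 1) := by
      rw [mul_sub, mul_add, pow_two, ← mul_assoc, hYX, one_mul, mul_one, add_comm]
    rw [hfac, mul_assoc, hmain, hYX]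
  have hcomm : Commute (1 + X - MonoidAlgebra.of F G x⁻¹) S :=
    Commute.sum_right _ _ _ fun i _ => .smul_right (.pow_right
      (((Commute.one_left X).add_left (.refl X)).sub_left (hYX.trans hXY.symm)) i) (a i)
  exact ⟨hleft, hcomm.eq ▸ hleft⟩
end

section
/- Let F be a field with char(F) = 0, G a group, and x ∈ G an element of even order n ≥ 4. Then 1 + (x + x⁻¹) is invertible in the group algebra FG if and only if n ≡ 2 (mod 6) or n ≡ 4 (mod 6). In particular, if n ≡ 0 (mod 6), then 1 + (x + x⁻¹) is not invertible in FG. -/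
open Polynomial in
lemma isCoprime_one_add_X_add_X_sq_X_pow_sub_one {F : Type*} [Field F] (h3 : (3 : F) ≠ 0)
    {n : ℕ} (hn : ¬ 3 ∣ n) : IsCoprime (1 + X + X ^ 2 : F[X]) (X ^ n - 1) := by
  have hsub : IsCoprime (1 + X + X ^ 2 : F[X]) (X - 1) := by
    refine ⟨C (3⁻¹), -C (3⁻¹) * (X + 2), ?_⟩
    have h : (C (3⁻¹) : F[X]) * 3 = 1 := by
      have : (3 : F[X]) = C 3 := rfl
      rw [this, ← C_mul, inv_mul_cancel₀ h3, C_1]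
    linear_combination h
  have hadd : IsCoprime (1 + X + X ^ 2 : F[X]) (X + 1) := ⟨1, -X, by ring⟩
  have hrem : IsCoprime (1 + X + X ^ 2 : F[X]) (X ^ (n % 3) - 1) := by
    have hcases : n % 3 = 1 ∨ n % 3 = 2 := by omega
    rcases hcases with h | h
    · simpa [h] using hsub
    · have : (X ^ (n % 3) - 1 : F[X]) = (X - 1) * (X + 1) := by rw [h]; ring
      rw [this]
      exact hsub.mul_right hadd
  obtain ⟨c, hc⟩ : (1 + X + X ^ 2 : F[X]) ∣ (X ^ 3) ^ (n / 3) - 1 :=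
    (Dvd.intro (X - 1) (by ring)).trans (sub_one_dvd_pow_sub_one (X ^ 3 : F[X]) (n / 3))
  have : (X ^ n - 1 : F[X]) =
      X ^ (n % 3) - 1 + (1 + X + X ^ 2) * (X ^ (n % 3) * c) := by
    conv_lhs => rw [← Nat.mod_add_div n 3, pow_add, pow_mul]
    linear_combination X ^ (n % 3) * hc
  rw [this]
  exact hrem.add_mul_left_right _

lemma MonoidAlgebra.linearIndependent_of (R M : Type*) [Semiring R] [MulOneClass M] :
    LinearIndependent R (MonoidAlgebra.of R M) :=
  (MonoidAlgebra.basis M R).linearIndependent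

open Polynomial in
lemma MonoidAlgebra.eq_zero_of_aeval_of_eq_zero {F G : Type*} [Field F] [Group G] {x : G}
    {p : F[X]} (hdeg : p.natDegree < orderOf x)
    (hp : aeval (MonoidAlgebra.of F G x) p = 0) : p = 0 := by
  have hsum : ∑ i ∈ Finset.range (orderOf x), p.coeff i • MonoidAlgebra.of F G (x ^ i) = 0 := by
    rw [← hp, aeval_eq_sum_range' hdeg]
    simp only [map_pow]
  have hinj : Set.InjOn (fun i : ℕ ↦ x ^ i) (Finset.range (orderOf x)) := by
    simpa using pow_injOn_Iio_orderOf (x := x)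
  have hli : LinearIndepOn F (fun i : ℕ ↦ MonoidAlgebra.of F G (x ^ i))
      (Finset.range (orderOf x) : Set ℕ) :=
    (MonoidAlgebra.linearIndependent_of F G).comp
      (fun i : (Finset.range (orderOf x) : Set ℕ) ↦ x ^ (i : ℕ)) hinj.injective
  ext i
  by_cases hi : i < orderOf x
  · simpa using linearIndepOn_finset_iff.mp hli _ hsum i (Finset.mem_range.mpr hi)
  · simpa using coeff_eq_zero_of_natDegree_lt (by omega)

open Polynomial in
lemma MonoidAlgebra.isUnit_one_add_of_add_of_inv_iff {F G : Type*} [Field F] [Group G]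
    (h3 : (3 : F) ≠ 0) {x : G} (hx : 0 < orderOf x) :
    IsUnit (1 + (MonoidAlgebra.of F G x + MonoidAlgebra.of F G x⁻¹)) ↔ ¬ 3 ∣ orderOf x := by
  have hinv : MonoidAlgebra.of F G x * MonoidAlgebra.of F G x⁻¹ = 1 := by
    rw [← map_mul, mul_inv_cancel, map_one]
  have hux : IsUnit (MonoidAlgebra.of F G x) := (Group.isUnit x).map _
  have hpow : MonoidAlgebra.of F G x ^ orderOf x = 1 := by
    rw [← map_pow, pow_orderOf_eq_one, map_one]
  have haeval : aeval (MonoidAlgebra.of F G x) (1 + X + X ^ 2 : F[X]) =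
      MonoidAlgebra.of F G x * (1 + (MonoidAlgebra.of F G x + MonoidAlgebra.of F G x⁻¹)) := by
    rw [mul_add, mul_add, hinv]
    simp only [map_add, map_one, map_mul, aeval_X, mul_one, sq]
    abel
  have hroot : aeval (MonoidAlgebra.of F G x) (X ^ orderOf x - 1 : F[X]) = 0 := by
    rw [map_sub, map_pow, aeval_X, map_one, hpow, sub_self]
  have hiff : IsUnit (1 + (MonoidAlgebra.of F G x + MonoidAlgebra.of F G x⁻¹)) ↔
      IsUnit (aeval (MonoidAlgebra.of F G x) (1 + X + X ^ 2 : F[X])) := by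
    rw [haeval, ← hux.unit_spec, Units.isUnit_units_mul]
  rw [hiff]
  constructor
  · rintro hunit ⟨m, hm⟩
    obtain ⟨q, hq⟩ : (1 + X + X ^ 2 : F[X]) ∣ X ^ orderOf x - 1 := by
      rw [hm, pow_mul]
      exact (Dvd.intro (X - 1) (by ring)).trans (sub_one_dvd_pow_sub_one (X ^ 3 : F[X]) m)
    have hne : (X ^ orderOf x - 1 : F[X]) ≠ 0 := by
      simpa using X_pow_sub_C_ne_zero hx (1 : F)
    have hdeg : (X ^ orderOf x - 1 : F[X]).natDegree = orderOf x := by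
      simpa using natDegree_X_pow_sub_C (n := orderOf x) (r := (1 : F))
    have hdeg2 : (1 + X + X ^ 2 : F[X]).natDegree = 2 := by compute_degree!
    have hq0 : q ≠ 0 := by
      rintro rfl
      exact hne (by rw [hq, mul_zero])
    have hw0 : (1 + X + X ^ 2 : F[X]) ≠ 0 := by
      rintro h
      exact hne (by rw [hq, h, zero_mul])
    rw [hq, natDegree_mul hw0 hq0, hdeg2] at hdeg
    rw [hq, map_mul, hunit.mul_right_eq_zero] at hroot
    exact hq0 (eq_zero_of_aeval_of_eq_zero (by omega) hroot)
  · intro hn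
    obtain ⟨a, b, hab⟩ := isCoprime_one_add_X_add_X_sq_X_pow_sub_one h3 hn
    have h := congrArg (aeval (MonoidAlgebra.of F G x)) hab
    rw [map_add, map_mul _ b, hroot, mul_zero, add_zero, map_one] at h
    refine isUnit_iff_exists.mpr ⟨aeval (MonoidAlgebra.of F G x) a, ?_, ?_⟩
    · rw [← map_mul, mul_comm, h]
    · rw [← map_mul, h]


/-- Over a field of characteristic `0`, if `x ∈ G` has even order `n ≥ 4`,
then `1 + (x + x⁻¹)` is invertible in `FG` if and only if `n ≡ 2 (mod 6)` or
`n ≡ 4 (mod 6)`; in particular, if `n ≡ 0 (mod 6)` it is not invertible. -/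
theorem one_add_sym_isUnit_iff (F : Type*) [Field F] [CharZero F]
    {G : Type*} [Group G] (x : G) (n : ℕ) (hn : orderOf x = n) (heven : Even n)
    (hn4 : 4 ≤ n) :
    (IsUnit (1 + (MonoidAlgebra.of F G x + MonoidAlgebra.of F G x⁻¹)) ↔
      (n % 6 = 2 ∨ n % 6 = 4)) ∧
    (n % 6 = 0 → ¬ IsUnit (1 + (MonoidAlgebra.of F G x + MonoidAlgebra.of F G x⁻¹))) := by
  subst hn
  rw [MonoidAlgebra.isUnit_one_add_of_add_of_inv_iff three_ne_zero (by omega)]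
  obtain ⟨k, hk⟩ := heven
  omega
end

section
/- Let F be a field with char(F) = 0, G a group, and x ∈ G an element of order n with n even and n ≡ 2 (mod 6), n ≥ 4. Then 1 + (x + x⁻¹) is invertible in FG and its inverse is a₀ + a₁x + a₂x² + ⋯ + a_{n−1}x^{n−1}, where for 0 ≤ k ≤ n−1: a_k = −1/3 if k ≡ 0 or 2 (mod 3), and a_k = 2/3 if k ≡ 1 (mod 3). -/
open Polynomial in
/-- A closed form for `(1 + X + X²) ∑ aₖ Xᵏ`, where `a` has period `3` with values `-c, 2c, -c`. -/
theorem one_add_X_add_X_sq_mul_sum_period_three {R : Type*} [CommRing R] (c : R) (m : ℕ) :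
    (1 + X + X ^ 2 : R[X]) *
        ∑ k ∈ Finset.range (3 * m + 2), C (if k % 3 = 1 then 2 * c else -c) * X ^ k =
      C c * (-1 + X + X ^ (3 * m + 2) + 2 * X ^ (3 * m + 3)) := by
  have hC : (C 2 : R[X]) = 2 := C_ofNat 2
  induction m with
  | zero =>
    simp [Finset.sum_range_succ, hC]
    ring
  | succ m ih =>
    have h0 : (3 * m + 2) % 3 = 2 := by omega
    have h1 : (3 * m + 2 + 1) % 3 = 0 := by omega
    have h2 : (3 * m + 2 + 1 + 1) % 3 = 1 := by omega
    rw [show 3 * (m + 1) + 2 = 3 * m + 2 + 1 + 1 + 1 by ring, Finset.sum_range_succ,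
      Finset.sum_range_succ, Finset.sum_range_succ, mul_add, mul_add, mul_add, ih, h0, h1, h2]
    simp [hC]
    ring

open Polynomial in
/-- In an algebra over a field with `3 ≠ 0`, an element `u` with `u ^ (3 * m + 2) = 1`
satisfies `(1 + u + u²) ∑ aₖ uᵏ = u`, where `a` has period `3` with values `-1/3, 2/3, -1/3`. -/
theorem one_add_add_sq_mul_sum_eq_self {F A : Type*} [Field F] [Ring A] [Algebra F A]
    (h3 : (3 : F) ≠ 0) (u : A) (m : ℕ) (hu : u ^ (3 * m + 2) = 1) :
    (1 + u + u ^ 2) * ∑ k ∈ Finset.range (3 * m + 2),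
      (if k % 3 = 1 then 2 / 3 else -(1 / 3) : F) • u ^ k = u := by
  have h := congrArg (aeval u) (one_add_X_add_X_sq_mul_sum_period_three (1 / 3 : F) m)
  simp only [map_mul, map_add, map_one, map_pow, aeval_X, map_sum, aeval_C, map_neg,
    ← Algebra.smul_def, pow_succ u (3 * m + 2), hu, one_mul, map_ofNat] at h
  rw [show (2 / 3 : F) = 2 * (1 / 3) by ring, h,
    show -1 + u + 1 + 2 * u = (3 : F) • u by
      rw [Algebra.smul_def, map_ofNat]; noncomm_ring,
    smul_smul, one_div_mul_cancel h3, one_smul]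

/-- Over a field of characteristic `0`, if `x ∈ G` has even order `n ≥ 4`
with `n ≡ 2 (mod 6)`, then `1 + (x + x⁻¹)` is invertible in `FG` with inverse
`∑_{k=0}^{n-1} aₖ xᵏ`, where `aₖ = -1/3` if `k ≡ 0, 2 (mod 3)` and `aₖ = 2/3` if
`k ≡ 1 (mod 3)`. -/
theorem inverse_coeffs_n_mod_six_eq_two (F : Type*) [Field F] [CharZero F]
    {G : Type*} [Group G] (x : G) (n : ℕ) (hn : orderOf x = n) (heven : Even n)
    (hn4 : 4 ≤ n) (hmod : n % 6 = 2) :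
    let X : MonoidAlgebra F G := MonoidAlgebra.of F G x
    let a : ℕ → F := fun k => if k % 3 = 1 then 2 / 3 else -(1 / 3)
    let S : MonoidAlgebra F G := ∑ k ∈ Finset.range n, a k • X ^ k
    (1 + (X + MonoidAlgebra.of F G x⁻¹)) * S = 1 ∧
      S * (1 + (X + MonoidAlgebra.of F G x⁻¹)) = 1 := by
  intro X a S
  have hX : X ^ n = 1 := by
    rw [← map_pow, ← hn, pow_orderOf_eq_one, map_one]
  set Y : MonoidAlgebra F G := MonoidAlgebra.of F G x⁻¹
  have hYX : Y * X = 1 := by rw [← map_mul, inv_mul_cancel, map_one]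
  have hXY : X * Y = 1 := by rw [← map_mul, mul_inv_cancel, map_one]
  obtain ⟨m, rfl⟩ : ∃ m, n = 3 * m + 2 := ⟨n / 3, by omega⟩
  have hS : (1 + X + X ^ 2) * S = X :=
    one_add_add_sq_mul_sum_eq_self three_ne_zero X m hX
  have hfactor : 1 + (X + Y) = Y * (1 + X + X ^ 2) := by
    rw [mul_add, mul_add, mul_one, hYX, sq, ← mul_assoc, hYX, one_mul]
    abel
  have hleft : (1 + (X + Y)) * S = 1 := by rw [hfactor, mul_assoc, hS, hYX]
  have hXS : Commute S X :=
    Commute.sum_left _ _ _ fun k _ => ((Commute.refl X).pow_left k).smul_left (a k)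
  have hYS : Commute S Y := by
    calc S * Y = Y * X * S * Y := by rw [hYX, one_mul]
      _ = Y * S * (X * Y) := by rw [mul_assoc Y, ← hXS.eq]; simp only [mul_assoc]
      _ = Y * S := by rw [hXY, mul_one]
  refine ⟨hleft, ?_⟩
  rw [((Commute.one_right S).add_right (hXS.add_right hYS)).eq, hleft]
end

section
/- Let F be a field with char(F) = 0, G a group, and x ∈ G an element of order n with n even and n ≡ 4 (mod 6), n ≥ 4. Then 1 + (x + x⁻¹) is invertible in FG and its inverse is a₀ + a₁x + a₂x² + ⋯ + a_{n−1}x^{n−1}, where for 0 ≤ k ≤ n−1: a_k = 1/3 if k ≡ 0 or 1 (mod 3), and a_k = −2/3 if k ≡ 2 (mod 3). -/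
open Polynomial in
/-- The truncated series with coefficients `1/3, 1/3, -2/3` repeated periodically,
multiplied by `1 + X + X ^ 2`. -/
theorem one_add_X_add_X_sq_mul_sum_range (F : Type*) [Field F] [CharZero F] (m : ℕ) :
    (1 + X + X ^ 2 : F[X]) *
        ∑ k ∈ Finset.range (3 * m + 1), (if k % 3 = 2 then -(2 / 3) else 1 / 3 : F) • X ^ k =
      X + C (1 / 3) * (1 - X) * (1 - X ^ (3 * m + 1)) := by
  have hC : (3 : F[X]) * C (1 / 3) = 1 := by
    rw [← C_ofNat, ← C_mul]
    norm_num
  have hC' : (C (-(2 / 3)) : F[X]) = -2 * C (1 / 3) := by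
    rw [← C_ofNat, ← C_neg, ← C_mul]
    congr 1
    ring
  induction m with
  | zero =>
    simp only [mul_zero, zero_add, Finset.sum_range_one, Nat.zero_mod, OfNat.zero_ne_ofNat,
      if_false, smul_eq_C_mul]
    linear_combination X * hC
  | succ m ih =>
    rw [show 3 * (m + 1) + 1 = 3 * m + 1 + 1 + 1 + 1 by ring, Finset.sum_range_succ,
      Finset.sum_range_succ, Finset.sum_range_succ, mul_add, mul_add, mul_add, ih,
      if_neg (by omega), if_pos (by omega), if_neg (by omega)]
    simp only [smul_eq_C_mul, hC']
    ring

/-- Over a field of characteristic `0`, if `x ∈ G` has even order `n ≥ 4`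
with `n ≡ 4 (mod 6)`, then `1 + (x + x⁻¹)` is invertible in `FG` with inverse
`∑_{k=0}^{n-1} aₖ xᵏ`, where `aₖ = 1/3` if `k ≡ 0, 1 (mod 3)` and `aₖ = -2/3` if
`k ≡ 2 (mod 3)`. -/
theorem inverse_coeffs_n_mod_six_eq_four (F : Type*) [Field F] [CharZero F]
    {G : Type*} [Group G] (x : G) (n : ℕ) (hn : orderOf x = n) (heven : Even n)
    (hn4 : 4 ≤ n) (hmod : n % 6 = 4) :
    let X : MonoidAlgebra F G := MonoidAlgebra.of F G x
    let a : ℕ → F := fun k => if k % 3 = 2 then -(2 / 3) else 1 / 3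
    let S : MonoidAlgebra F G := ∑ k ∈ Finset.range n, a k • X ^ k
    (1 + (X + MonoidAlgebra.of F G x⁻¹)) * S = 1 ∧
      S * (1 + (X + MonoidAlgebra.of F G x⁻¹)) = 1 := by
  intro X a S
  have hX : X ^ n = 1 := by
    rw [← map_pow, ← hn, pow_orderOf_eq_one, map_one]
  have hYX : MonoidAlgebra.of F G x⁻¹ * X = 1 := by
    rw [← map_mul, inv_mul_cancel, map_one]
  have hXY : X * MonoidAlgebra.of F G x⁻¹ = 1 := by
    rw [← map_mul, mul_inv_cancel, map_one]
  have hS : (1 + X + X ^ 2) * S = X := by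
    obtain ⟨m, rfl⟩ : ∃ m, n = 3 * m + 1 := ⟨n / 3, by omega⟩
    simpa only [map_mul, map_add, map_sub, map_one, map_pow, map_sum, map_smul,
      Polynomial.aeval_X, hX, sub_self, mul_zero, add_zero] using
      congrArg (Polynomial.aeval X) (one_add_X_add_X_sq_mul_sum_range F m)
  have hu : 1 + (X + MonoidAlgebra.of F G x⁻¹) =
      MonoidAlgebra.of F G x⁻¹ * (1 + X + X ^ 2) := by
    rw [mul_add, mul_add, pow_two, ← mul_assoc, hYX, mul_one, one_mul]
    abel
  have hleft : (1 + (X + MonoidAlgebra.of F G x⁻¹)) * S = 1 := by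
    rw [hu, mul_assoc, hS, hYX]
  have hXS : Commute X S :=
    Commute.sum_right _ _ _ fun k _ => (Commute.self_pow X k).smul_right (a k)
  have hYS : Commute (MonoidAlgebra.of F G x⁻¹) S :=
    hXS.units_inv_left (u := ⟨X, MonoidAlgebra.of F G x⁻¹, hXY, hYX⟩)
  exact ⟨hleft, by rw [← ((Commute.one_left S).add_left (hXS.add_left hYS)).eq, hleft]⟩
end

section
/- Let F be a field with char(F) = 0, G a group, and z ∈ G an element of order 4. Then 1 + (z + z⁻¹) is invertible in FG with (1 + (z + z⁻¹))⁻¹ = 1/3 + (1/3)z − (2/3)z² + (1/3)z³, and (1 − (z + z⁻¹))·(1 + (z + z⁻¹))⁻¹ = −1/3 + (2/3)z − (4/3)z² + (2/3)z³. -/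
theorem one_add_self_add_pow_three_mul {F A : Type*} [Field F] [CharZero F] [Ring A] [Algebra F A]
    {Z : A} (hZ : Z ^ 4 = 1) :
    (1 + (Z + Z ^ 3)) *
      ((1 / 3 : F) • 1 + (1 / 3 : F) • Z - (2 / 3 : F) • Z ^ 2 + (1 / 3 : F) • Z ^ 3) = 1 := by
  have h5 : Z ^ 5 = Z := by rw [pow_succ, hZ, one_mul]
  have h6 : Z ^ 6 = Z ^ 2 := by rw [pow_add Z 4 2, hZ, one_mul]
  simp only [mul_add, mul_sub, add_mul, one_mul, mul_one, mul_smul_comm, ← pow_succ, ← pow_succ',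
    ← pow_add, ← pow_two Z, Nat.reduceAdd, hZ, h5, h6]
  module

/-- Over a field of characteristic `0`, if `z ∈ G` has order `4`, then
`1 + (z + z⁻¹)` is invertible in `FG` with inverse `1/3 + (1/3)z - (2/3)z² + (1/3)z³`,
and `(1 - (z + z⁻¹))(1 + (z + z⁻¹))⁻¹ = -1/3 + (2/3)z - (4/3)z² + (2/3)z³`. -/
theorem cayley_order_four_sym (F : Type*) [Field F] [CharZero F]
    {G : Type*} [Group G] (z : G) (hz : orderOf z = 4) :
    let Z : MonoidAlgebra F G := MonoidAlgebra.of F G z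
    let β : MonoidAlgebra F G := Z + MonoidAlgebra.of F G z⁻¹
    let S : MonoidAlgebra F G :=
      (1 / 3 : F) • 1 + (1 / 3 : F) • Z - (2 / 3 : F) • Z ^ 2 + (1 / 3 : F) • Z ^ 3
    (1 + β) * S = 1 ∧ S * (1 + β) = 1 ∧
      (1 - β) * S =
        -((1 / 3 : F) • (1 : MonoidAlgebra F G)) + (2 / 3 : F) • Z - (4 / 3 : F) • Z ^ 2 +
          (2 / 3 : F) • Z ^ 3 := by
  intro Z β S
  have hZ : Z ^ 4 = 1 := by
    rw [← map_pow, ← hz, pow_orderOf_eq_one, map_one]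
  have hinv : MonoidAlgebra.of F G z⁻¹ = Z ^ 3 := by
    rw [← map_pow]
    congr 1
    rw [inv_eq_iff_mul_eq_one, ← pow_succ', ← pow_orderOf_eq_one z, hz]
  have hβ : β = Z + Z ^ 3 := by rw [← hinv]
  have hmul : (1 + β) * S = 1 := by
    rw [hβ]
    exact one_add_self_add_pow_three_mul hZ
  have hcomm : Commute (1 + β) S := by
    rw [hβ]
    have h (n : ℕ) (a : F) : Commute (1 + (Z + Z ^ 3)) (a • Z ^ n) :=
      ((Commute.one_left _).add_left
        ((Commute.self_pow Z n).add_left (Commute.pow_pow_self Z 3 n))).smul_right a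
    simpa [S] using (((h 0 (1 / 3)).add_right (h 1 (1 / 3))).sub_right (h 2 (2 / 3))).add_right
      (h 3 (1 / 3))
  refine ⟨hmul, hcomm.eq ▸ hmul, ?_⟩
  have hsub : (1 - β) * S = (2 : F) • S - 1 := by
    have h : S + β * S = 1 := by rw [← hmul, add_mul 1 β, one_mul]
    rw [two_smul, sub_mul 1 β, one_mul, ← h]
    abel
  rw [hsub]
  simp only [S]
  module
end
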